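/- Fix an integer M ≥ 0 and indeterminates c_0,…,c_M, and let P(X) = Σ_{a=0}^{M} c_a X^a, Q(X) = X^2 − 2·P(X^2). The polynomial Q(r+s) − Q(r−s) ∈ ℚ[c_0,…,c_M][r,s] is divisible by 4s; let V = (Q(r+s) − Q(r−s))/(4s). Then for every even integer N ≥ 2 with N ≤ M, the coefficient of the monomial r^N s^N in 2r·( s·(∂V/∂s) − r·(∂V/∂r) ) + ( Q(r+s) + Q(r−s) )/2 equals −binom(2N+2, N+1)·c_N. -/

import Mathlib

/-!
Statement 10.  Fix `M ≥ 0`, indeterminates `c_0,…,c_M`, `P(X) = ∑_{a=0}^M c_a X^a` and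
`Q(X) = X² - 2 P(X²)`.  With `V = (Q(r+s) - Q(r-s))/(4s)` (the numerator is divisible by
`4s`; `V` is encoded by the hypothesis `4 s V = Q(r+s) - Q(r-s)`, which determines it
uniquely), for every even `N ≥ 2` with `N ≤ M` the coefficient of `r^N s^N` in
`2r (s ∂V/∂s - r ∂V/∂r) + (Q(r+s) + Q(r-s))/2` equals `-binom(2N+2, N+1) ⬝ c_N`.

Computations take place in `ℚ[c_0,…,c_M][r,s]`, realised as
`MvPolynomial (Fin 2) (MvPolynomial (Fin (M+1)) ℚ)` with `r = X 0`, `s = X 1`.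
-/

noncomputable section

/-- The coefficient ring `ℚ[c_0,…,c_M]`. -/
abbrev Rc (M : ℕ) : Type := MvPolynomial (Fin (M + 1)) ℚ

/-- The polynomial ring `ℚ[c_0,…,c_M][r,s]`. -/
abbrev Rrs (M : ℕ) : Type := MvPolynomial (Fin 2) (Rc M)

/-- The variable `r`. -/
def rP (M : ℕ) : Rrs M := MvPolynomial.X 0

/-- The variable `s`. -/
def sP (M : ℕ) : Rrs M := MvPolynomial.X 1

/-- `Q(t) = t² - 2 P(t²) = t² - 2 ∑_{a=0}^M c_a t^{2a}`. -/
def Qof (M : ℕ) (t : Rrs M) : Rrs M :=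
  t ^ 2 - 2 * ∑ a : Fin (M + 1), MvPolynomial.C (MvPolynomial.X a) * t ^ (2 * (a : ℕ))

/-- The Euler operator `X i * ∂/∂X i` multiplies the coefficient at `m` by `m i`. -/
theorem coeff_X_mul_pderiv {σ R : Type*} [CommSemiring R] (i : σ) (p : MvPolynomial σ R)
    (m : σ →₀ ℕ) :
    MvPolynomial.coeff m (MvPolynomial.X i * MvPolynomial.pderiv i p) =
      m i * MvPolynomial.coeff m p := by
  classical
  induction p using MvPolynomial.induction_on' with
  | add p q hp hq => rw [map_add, mul_add, MvPolynomial.coeff_add, hp, hq, MvPolynomial.coeff_add,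
      mul_add]
  | monomial n a =>
    rw [MvPolynomial.X_mul_pderiv_monomial, MvPolynomial.coeff_smul, MvPolynomial.coeff_monomial]
    split_ifs with h
    · rw [h, nsmul_eq_mul]
    · simp

/-- The coefficients of `(r + e s) ^ n`. -/
theorem coeff_X_add_C_mul_X_pow {R : Type*} [CommSemiring R] (e : R) (n i j : ℕ) :
    MvPolynomial.coeff (Finsupp.single (0 : Fin 2) i + Finsupp.single (1 : Fin 2) j)
        ((MvPolynomial.X 0 + MvPolynomial.C e * MvPolynomial.X 1) ^ n) =
      if i + j = n then (n.choose j : R) * e ^ j else 0 := by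
  classical
  have expand : (MvPolynomial.X (0 : Fin 2) + MvPolynomial.C e * MvPolynomial.X 1) ^ n =
      ∑ k ∈ Finset.range (n + 1), MvPolynomial.monomial
        (Finsupp.single (0 : Fin 2) (n - k) + Finsupp.single (1 : Fin 2) k)
        ((n.choose k : R) * e ^ k) := by
    rw [add_comm, add_pow]
    refine Finset.sum_congr rfl fun k _ => ?_
    rw [MvPolynomial.monomial_eq, Finsupp.prod_fintype _ _ (by simp)]
    simp only [Fin.prod_univ_two, mul_pow, map_mul, map_pow, map_natCast]
    simp
    ring
  have index_eq (k : ℕ) : (Finsupp.single (0 : Fin 2) (n - k) + Finsupp.single (1 : Fin 2) k =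
      Finsupp.single 0 i + Finsupp.single 1 j) ↔ n - k = i ∧ k = j := by
    simp [Finsupp.ext_iff, Fin.forall_fin_two]
  simp only [expand, MvPolynomial.coeff_sum, MvPolynomial.coeff_monomial, index_eq]
  split_ifs with h
  · rw [Finset.sum_eq_single j]
    · rw [if_pos ⟨by omega, rfl⟩]
    · intro k _ hk
      rw [if_neg fun hc => hk hc.2]
    · intro hj
      simp at hj
      omega
  · refine Finset.sum_eq_zero fun k hk => if_neg ?_
    simp at hk
    omega

/-- The coefficients of `Q(r + e s)` in total degree `2N ≥ 4`. -/
theorem coeff_Qof_add_C_mul (M N : ℕ) (hN : 2 ≤ N) (hNM : N < M + 1) (e : Rc M) (i j : ℕ)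
    (hij : i + j = 2 * N) :
    MvPolynomial.coeff (Finsupp.single (0 : Fin 2) i + Finsupp.single (1 : Fin 2) j)
        (Qof M (rP M + MvPolynomial.C e * sP M)) =
      -2 * (((2 * N).choose j : Rc M) * e ^ j) * MvPolynomial.X (⟨N, hNM⟩ : Fin (M + 1)) := by
  have htwo : (2 : Rrs M) = MvPolynomial.C 2 := (map_ofNat _ 2).symm
  rw [Qof, rP, sP, MvPolynomial.coeff_sub, htwo, MvPolynomial.coeff_C_mul,
    MvPolynomial.coeff_sum, coeff_X_add_C_mul_X_pow, if_neg (by omega),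
    Finset.sum_eq_single (⟨N, hNM⟩ : Fin (M + 1))]
  · rw [MvPolynomial.coeff_C_mul, coeff_X_add_C_mul_X_pow, if_pos hij]
    ring
  · intro a _ ha
    rw [MvPolynomial.coeff_C_mul, coeff_X_add_C_mul_X_pow, if_neg, mul_zero]
    intro h
    exact ha (Fin.ext (by simp only; omega))
  · simp

/-- For even `N ≥ 2` with `N ≤ M`, the coefficient of `r^N s^N` in
`2r (s ∂V/∂s - r ∂V/∂r) + (Q(r+s) + Q(r-s))/2` equals `-binom(2N+2, N+1) ⬝ c_N`. -/
theorem statement10 (M N : ℕ) (hNeven : Even N) (hN2 : 2 ≤ N) (hNM : N ≤ M)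
    (V : Rrs M) (hV : 4 * sP M * V = Qof M (rP M + sP M) - Qof M (rP M - sP M)) :
    MvPolynomial.coeff (Finsupp.single (0 : Fin 2) N + Finsupp.single (1 : Fin 2) N)
        (2 * rP M *
            (sP M * MvPolynomial.pderiv (1 : Fin 2) V - rP M * MvPolynomial.pderiv (0 : Fin 2) V) +
          ((1 : ℚ) / 2) • (Qof M (rP M + sP M) + Qof M (rP M - sP M))) =
      -(((2 * N + 2).choose (N + 1) : Rc M)) * MvPolynomial.X (⟨N, by omega⟩ : Fin (M + 1)) := by
  obtain ⟨K, rfl⟩ : ∃ K, N = K + 1 := ⟨N - 1, by omega⟩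
  set c : Rc M := MvPolynomial.X (⟨K + 1, by omega⟩ : Fin (M + 1))
  have hplus (i j : ℕ) (hij : i + j = 2 * (K + 1)) :
      MvPolynomial.coeff (Finsupp.single (0 : Fin 2) i + Finsupp.single (1 : Fin 2) j)
        (Qof M (rP M + sP M)) = -2 * ((2 * (K + 1)).choose j : Rc M) * c := by
    have h := coeff_Qof_add_C_mul M (K + 1) hN2 (by omega) 1 i j hij
    rwa [map_one, one_mul, one_pow, mul_one] at h
  have hminus (i j : ℕ) (hij : i + j = 2 * (K + 1)) :
      MvPolynomial.coeff (Finsupp.single (0 : Fin 2) i + Finsupp.single (1 : Fin 2) j)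
        (Qof M (rP M - sP M)) = -2 * (((2 * (K + 1)).choose j : Rc M) * (-1) ^ j) * c := by
    have hsub : rP M - sP M = rP M + MvPolynomial.C (-1) * sP M := by
      rw [map_neg, map_one]
      ring
    rw [hsub]
    exact coeff_Qof_add_C_mul M (K + 1) hN2 (by omega) (-1) i j hij
  have hV_coeff : 4 * MvPolynomial.coeff
      (Finsupp.single (0 : Fin 2) K + Finsupp.single (1 : Fin 2) (K + 1)) V =
      -4 * ((2 * (K + 1)).choose (K + 2) : Rc M) * c := by
    have h := congrArg (MvPolynomial.coeff
      (Finsupp.single (0 : Fin 2) K + Finsupp.single (1 : Fin 2) (K + 2))) hV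
    have hfour : (4 : Rrs M) = MvPolynomial.C 4 := (map_ofNat _ 4).symm
    have hidx : Finsupp.single (0 : Fin 2) K + Finsupp.single (1 : Fin 2) (K + 2) =
        Finsupp.single 1 1 +
          (Finsupp.single (0 : Fin 2) K + Finsupp.single (1 : Fin 2) (K + 1)) := by
      rw [add_left_comm, ← Finsupp.single_add, add_comm 1 (K + 1)]
    rw [MvPolynomial.coeff_sub, hplus _ _ (by omega), hminus _ _ (by omega), mul_assoc, hfour,
      MvPolynomial.coeff_C_mul, hidx, sP, MvPolynomial.coeff_X_mul,
      Odd.neg_one_pow (by simpa [parity_simps] using hNeven)] at h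
    rw [h]
    ring
  have hidx : Finsupp.single (0 : Fin 2) (K + 1) + Finsupp.single (1 : Fin 2) (K + 1) =
      Finsupp.single 0 1 +
        (Finsupp.single (0 : Fin 2) K + Finsupp.single (1 : Fin 2) (K + 1)) := by
    rw [← add_assoc, ← Finsupp.single_add, add_comm 1 K]
  have htwo : (2 : Rrs M) = MvPolynomial.C 2 := (map_ofNat _ 2).symm
  have hderiv : MvPolynomial.coeff
      (Finsupp.single (0 : Fin 2) (K + 1) + Finsupp.single (1 : Fin 2) (K + 1))
      (2 * rP M * (sP M * MvPolynomial.pderiv (1 : Fin 2) V -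
        rP M * MvPolynomial.pderiv (0 : Fin 2) V)) =
      2 * MvPolynomial.coeff
        (Finsupp.single (0 : Fin 2) K + Finsupp.single (1 : Fin 2) (K + 1)) V := by
    rw [mul_assoc, htwo, MvPolynomial.coeff_C_mul, hidx, rP, sP, MvPolynomial.coeff_X_mul,
      MvPolynomial.coeff_sub, coeff_X_mul_pderiv, coeff_X_mul_pderiv]
    simp
    ring
  have hpascal : (2 * (K + 1) + 2).choose (K + 1 + 1) =
      2 * ((2 * (K + 1)).choose (K + 1) + (2 * (K + 1)).choose (K + 2)) := by
    have hsymm := Nat.choose_symm_half (K + 1)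
    rw [Nat.choose_succ_succ, ← hsymm, ← Nat.choose_succ_succ]
    ring
  rw [MvPolynomial.coeff_add, hderiv, MvPolynomial.coeff_smul, MvPolynomial.coeff_add,
    hplus _ _ (by omega), hminus _ _ (by omega), hNeven.neg_one_pow, hpascal]
  have hhalf (x : Rc M) : ((1 : ℚ) / 2) • (x + x) = x := by
    rw [← two_smul ℚ x, smul_smul]
    norm_num
  rw [mul_one, hhalf]
  apply mul_left_cancel₀ (two_ne_zero : (2 : Rc M) ≠ 0)
  push_cast
  linear_combination hV_coeff
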